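/- Let λ > 0 and z ∈ ℝ⁴ with z_i ≥ 0 for all i. Then f(w) = (1/2)‖w − z‖² + λ(w₁w₂w₃ + w₂w₃w₄ + w₃w₄w₁ + w₄w₁w₂) attains its minimum over the nonnegative orthant ℝ₊⁴, and there exists a minimizer w* satisfying 0 ≤ w*_i ≤ z_i for all i ∈ {1,2,3,4}. -/

import Mathlib

/-- The smooth 2:4 objective `f(w) = (1/2)‖w − z‖² + λ(w₁w₂w₃ + w₂w₃w₄ + w₃w₄w₁ + w₄w₁w₂)`. -/
noncomputable def fObj (lam : ℝ) (z w : Fin 4 → ℝ) : ℝ :=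
  (1 / 2) * (∑ i, (w i - z i) ^ 2) +
    lam * (w 0 * w 1 * w 2 + w 1 * w 2 * w 3 + w 2 * w 3 * w 0 + w 3 * w 0 * w 1)

/-- Truncating a nonnegative point coordinatewise at `z` does not increase the objective. -/
theorem fObj_inf_le {lam : ℝ} (hlam : 0 ≤ lam) {z u : Fin 4 → ℝ} (hz : ∀ i, 0 ≤ z i)
    (hu : ∀ i, 0 ≤ u i) : fObj lam z (u ⊓ z) ≤ fObj lam z u := by
  have hnonneg : ∀ i, 0 ≤ (u ⊓ z) i := fun i => le_inf (hu i) (hz i)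
  have hle : ∀ i, (u ⊓ z) i ≤ u i := fun i => inf_le_left
  have hsq : ∀ i, ((u ⊓ z) i - z i) ^ 2 ≤ (u i - z i) ^ 2 := by
    intro i
    rcases le_total (u i) (z i) with h | h <;> simp [h]
  have hmul : ∀ i j k, (u ⊓ z) i * (u ⊓ z) j * (u ⊓ z) k ≤ u i * u j * u k := fun i j k =>
    mul_le_mul (mul_le_mul (hle i) (hle j) (hnonneg j) (hu i)) (hle k) (hnonneg k)
      (mul_nonneg (hu i) (hu j))
  unfold fObj
  refine add_le_add (mul_le_mul_of_nonneg_left (Finset.sum_le_sum fun i _ => hsq i) (by norm_num))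
    (mul_le_mul_of_nonneg_left ?_ hlam)
  exact add_le_add (add_le_add (add_le_add (hmul 0 1 2) (hmul 1 2 3)) (hmul 2 3 0)) (hmul 3 0 1)

theorem continuous_fObj (lam : ℝ) (z : Fin 4 → ℝ) : Continuous (fObj lam z) := by
  unfold fObj
  fun_prop

/-- **Existence of a minimizer in the box `0 ≤ w ≤ z`:** `f` attains its minimum over the
nonnegative orthant `ℝ₊⁴` at some `w*` with `0 ≤ w*ᵢ ≤ zᵢ` for all `i`. -/
theorem minimizer_exists_in_box (lam : ℝ) (hlam : 0 < lam) (z : Fin 4 → ℝ)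
    (hz : ∀ i, 0 ≤ z i) :
    ∃ wstar : Fin 4 → ℝ, (∀ i, 0 ≤ wstar i ∧ wstar i ≤ z i) ∧
      ∀ u : Fin 4 → ℝ, (∀ i, 0 ≤ u i) → fObj lam z wstar ≤ fObj lam z u := by
  obtain ⟨w, hw, hmin⟩ := (isCompact_Icc (a := (0 : Fin 4 → ℝ)) (b := z)).exists_isMinOn
    ⟨0, le_rfl, hz⟩ (continuous_fObj lam z).continuousOn
  refine ⟨w, fun i => ⟨hw.1 i, hw.2 i⟩, fun u hu => ?_⟩
  have hmem : u ⊓ z ∈ Set.Icc 0 z := ⟨le_inf hu hz, inf_le_right⟩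
  exact (hmin hmem).trans (fObj_inf_le hlam.le hz hu)
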